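/- arXiv:2210.07989 — 2 statements merged into one kernel-verified Lean document; each statement's English description precedes it below -/
import Mathlib

section
/- Let R be a subring of ℚ with R ≠ ℤ. Then there exists a family (V_x), indexed by subsets x of ℕ, of uncountable R-submodules of ℝ, each a countable union of closed subsets of ℝ, together with topologies τ_x on V_x, such that: each (V_x, τ_x) is a Polish space, a topological additive group, and scalar multiplication by each fixed element of R is τ_x-continuous; each τ_x refines the topology V_x inherits from ℝ (so the inclusion V_x → ℝ is a continuous injective R-module homomorphism); for all x, y ⊆ ℕ, if x \ y is finite then V_x ⊆ V_y and the inclusion map (V_x, τ_x) → (V_y, τ_y) is continuous; and for all x, y ⊆ ℕ, if x \ y is infinite then every map f : V_x → V_y that is continuous from τ_x to τ_y, additive, and satisfies f(r·m) = r·f(m) for all r ∈ R, m ∈ V_x, is constantly equal to zero. -/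
open Set Filter
open scoped ENNReal

/-- `a₀ a₁ ⋯ a_{n-1}` as a real number: the product of the first `n` terms of the
base sequence (the paper's `a₁ ⋯ a_n`, re-indexed from 0). -/
noncomputable def bProd (a : ℕ → ℕ) (n : ℕ) : ℝ := ∏ k ∈ Finset.range n, (a k : ℝ)

/-- The `n`-th digit (0-indexed; the paper's `(n+1)`-st digit) of the nonnegative
real `r` in base `a`:  `r_n = ⌊a₁⋯a_n (r - ⌊r⌋)⌋ - a_n ⌊a₁⋯a_{n-1} (r - ⌊r⌋)⌋`. -/
noncomputable def digit (a : ℕ → ℕ) (r : ℝ) (n : ℕ) : ℤ :=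
  ⌊bProd a (n + 1) * Int.fract r⌋ - (a n : ℤ) * ⌊bProd a n * Int.fract r⌋

/-- `j_a(r) = { n : r_n ≠ r_{n+1} }`. -/
def jSet (a : ℕ → ℕ) (r : ℝ) : Set ℕ := {n | digit a r n ≠ digit a r (n + 1)}

/-- An ideal of subsets of ℕ: closed under subsets and finite unions, containing
all singletons (hence nonempty). -/
def IsIdeal (I : Set (Set ℕ)) : Prop :=
  (∀ ⦃x y : Set ℕ⦄, x ∈ I → y ⊆ x → y ∈ I) ∧
  (∀ ⦃x y : Set ℕ⦄, x ∈ I → y ∈ I → x ∪ y ∈ I) ∧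
  (∀ n : ℕ, ({n} : Set ℕ) ∈ I)

/-- Translation invariance of a family of subsets of ℕ. -/
def TransInv (I : Set (Set ℕ)) : Prop :=
  ∀ x ∈ I, ({n | ∃ m ∈ x, n = m + 1} ∈ I) ∧ ({n | n + 1 ∈ x} ∈ I)

/-- A tall family: every infinite set of naturals has an infinite subset in the family. -/
def TallIdeal (I : Set (Set ℕ)) : Prop :=
  ∀ x : Set ℕ, x.Infinite → ∃ y, y ⊆ x ∧ y.Infinite ∧ y ∈ I

/-- The base sequence `a` is adapted to `I` if `{n : a_n ≠ a_{n+1}} ∈ I`. -/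
def AdaptedTo (a : ℕ → ℕ) (I : Set (Set ℕ)) : Prop := {n | a n ≠ a (n + 1)} ∈ I

/-- A lower semicontinuous submeasure on subsets of ℕ. -/
def IsLscSubmeasure (φ : Set ℕ → ℝ≥0∞) : Prop :=
  φ ∅ = 0 ∧
  (∀ ⦃x y : Set ℕ⦄, x ⊆ y → φ x ≤ φ y) ∧
  (∀ x y : Set ℕ, φ (x ∪ y) ≤ φ x + φ y) ∧
  (∀ n : ℕ, 0 < φ {n} ∧ φ {n} < ⊤) ∧
  (∀ x : Set ℕ, φ x = ⨆ n : ℕ, φ (x ∩ {k | k < n}))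

/-- `Exh(φ) = { x ⊆ ℕ : φ(x \ {0,…,n-1}) → 0 }`. -/
def Exh (φ : Set ℕ → ℝ≥0∞) : Set (Set ℕ) :=
  {x | Filter.Tendsto (fun n => φ (x \ {k | k < n})) Filter.atTop (nhds 0)}

/-- `pr(a)`: the set of primes dividing `a_n` for all but finitely many `n`. -/
def prSet (a : ℕ → ℕ) : Set ℕ := {p | p.Prime ∧ ∀ᶠ n in Filter.atTop, p ∣ a n}

/-- A base sequence is uniform if every prime dividing some `a_n` divides `a_n`
for all but finitely many `n`. -/
def UniformBase (a : ℕ → ℕ) : Prop :=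
  ∀ p : ℕ, p.Prime → (∃ n, p ∣ a n) → ∀ᶠ n in Filter.atTop, p ∣ a n

/-- `ℚ_a`, viewed as a set of real numbers: fractions `k/l` with every prime
divisor of `l` in `pr(a)`. -/
def Qa (a : ℕ → ℕ) : Set ℝ :=
  {r | ∃ (k : ℤ) (l : ℕ), 0 < l ∧ (∀ p : ℕ, p.Prime → p ∣ l → p ∈ prSet a) ∧
    r = (k : ℝ) / (l : ℝ)}

/-- `H = { r ∈ ℝ : j_a(|r|) ∈ I }`. -/
def Hset (a : ℕ → ℕ) (I : Set (Set ℕ)) : Set ℝ := {r | jSet a |r| ∈ I}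

/-- `ρ(r,s) = φ(j_a(|r-s|)) + |r-s|`. -/
noncomputable def rho (a : ℕ → ℕ) (φ : Set ℕ → ℝ≥0∞) (r s : ℝ) : ℝ :=
  (φ (jSet a |r - s|)).toReal + |r - s|

/-- A lower semicontinuous extended group norm on `ℝ` dominating the absolute value. -/
structure IsExtNorm (N : ℝ → ℝ≥0∞) : Prop where
  map_zero : N 0 = 0
  map_neg : ∀ r, N (-r) = N r
  map_add_le : ∀ r s, N (r + s) ≤ N r + N s
  abs_le : ∀ r, ENNReal.ofReal |r| ≤ N r
  lsc : LowerSemicontinuous N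

namespace IsExtNorm

variable {N : ℝ → ℝ≥0∞}

lemma map_sub_le (hN : IsExtNorm N) (r s : ℝ) : N (r - s) ≤ N r + N s := by
  rw [sub_eq_add_neg, ← hN.map_neg s]
  exact hN.map_add_le r (-s)

lemma sub_comm (hN : IsExtNorm N) (r s : ℝ) : N (r - s) = N (s - r) := by
  rw [← hN.map_neg, neg_sub]

lemma add_ne_top (hN : IsExtNorm N) {r s : ℝ} (hr : N r ≠ ⊤) (hs : N s ≠ ⊤) : N (r + s) ≠ ⊤ :=
  ne_top_of_le_ne_top (ENNReal.add_ne_top.2 ⟨hr, hs⟩) (hN.map_add_le r s)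

lemma sub_ne_top (hN : IsExtNorm N) {r s : ℝ} (hr : N r ≠ ⊤) (hs : N s ≠ ⊤) : N (r - s) ≠ ⊤ :=
  ne_top_of_le_ne_top (ENNReal.add_ne_top.2 ⟨hr, hs⟩) (hN.map_sub_le r s)

lemma abs_le_toReal (hN : IsExtNorm N) {r : ℝ} (hr : N r ≠ ⊤) : |r| ≤ (N r).toReal :=
  (ENNReal.ofReal_le_iff_le_toReal hr).1 (hN.abs_le r)

lemma toReal_sub_eq_zero_iff (hN : IsExtNorm N) {r s : ℝ} (hr : N r ≠ ⊤) (hs : N s ≠ ⊤) :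
    (N (r - s)).toReal = 0 ↔ r = s := by
  refine ⟨fun h => ?_, fun h => by simp [h, hN.map_zero]⟩
  have := hN.abs_le_toReal (hN.sub_ne_top hr hs)
  rw [h] at this
  exact sub_eq_zero.1 (abs_nonpos_iff.1 this)

lemma toReal_add_le (hN : IsExtNorm N) {r s : ℝ} (hr : N r ≠ ⊤) (hs : N s ≠ ⊤) :
    (N (r + s)).toReal ≤ (N r).toReal + (N s).toReal := by
  rw [← ENNReal.toReal_add hr hs]
  exact ENNReal.toReal_mono (ENNReal.add_ne_top.2 ⟨hr, hs⟩) (hN.map_add_le r s)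

lemma toReal_triangle (hN : IsExtNorm N) {r s t : ℝ} (hr : N r ≠ ⊤) (hs : N s ≠ ⊤)
    (ht : N t ≠ ⊤) : (N (r - t)).toReal ≤ (N (r - s)).toReal + (N (s - t)).toReal := by
  rw [← sub_add_sub_cancel r s t]
  exact hN.toReal_add_le (hN.sub_ne_top hr hs) (hN.sub_ne_top hs ht)

lemma isClosed_le (hN : IsExtNorm N) (c : ℝ≥0∞) : IsClosed {r | N r ≤ c} :=
  hN.lsc.isClosed_preimage c

lemma finite_eq_iUnion (N : ℝ → ℝ≥0∞) : {r | N r ≠ ⊤} = ⋃ k : ℕ, {r | N r ≤ k} := by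
  ext r
  simp only [mem_ofPred_eq, mem_iUnion]
  refine ⟨fun h => ?_, fun ⟨k, hk⟩ => ne_top_of_le_ne_top (ENNReal.natCast_ne_top k) hk⟩
  obtain ⟨k, hk⟩ := ENNReal.exists_nat_gt h
  exact ⟨k, hk.le⟩

lemma complete (hN : IsExtNorm N) (u : ℕ → ℝ) (hu : ∀ n, N (u n) ≠ ⊤)
    (hc : ∀ ε : ℝ, 0 < ε → ∃ K : ℕ, ∀ m ≥ K, ∀ n ≥ K, (N (u m - u n)).toReal < ε) :
    ∃ r, N r ≠ ⊤ ∧ Tendsto (fun n => (N (u n - r)).toReal) atTop (nhds 0) := by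
  have hcau : CauchySeq u := by
    rw [Metric.cauchySeq_iff]
    intro ε hε
    obtain ⟨K, hK⟩ := hc ε hε
    refine ⟨K, fun m hm n hn => ?_⟩
    rw [Real.dist_eq]
    exact (hN.abs_le_toReal (hN.sub_ne_top (hu m) (hu n))).trans_lt (hK m hm n hn)
  obtain ⟨r, hr⟩ := cauchySeq_tendsto_of_complete hcau
  have key : ∀ ε : ℝ, 0 < ε → ∃ K : ℕ, ∀ m ≥ K, N (u m - r) ≤ ENNReal.ofReal ε := by
    intro ε hε
    obtain ⟨K, hK⟩ := hc ε hε
    refine ⟨K, fun m hm => ?_⟩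
    refine (hN.isClosed_le (ENNReal.ofReal ε)).mem_of_tendsto (hr.const_sub (u m)) ?_
    filter_upwards [eventually_ge_atTop K] with n hn
    exact (ENNReal.le_ofReal_iff_toReal_le (hN.sub_ne_top (hu m) (hu n)) hε.le).2
      (hK m hm n hn).le
  refine ⟨r, ?_, ?_⟩
  · obtain ⟨K, hK⟩ := key 1 one_pos
    have := hN.sub_ne_top (hu K) (ne_top_of_le_ne_top ENNReal.ofReal_ne_top (hK K le_rfl))
    rwa [sub_sub_cancel] at this
  · rw [Metric.tendsto_atTop]
    intro ε hε
    obtain ⟨K, hK⟩ := key (ε / 2) (half_pos hε)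
    refine ⟨K, fun n hn => ?_⟩
    rw [Real.dist_0_eq_abs, abs_of_nonneg ENNReal.toReal_nonneg]
    exact (ENNReal.toReal_le_of_le_ofReal (half_pos hε).le (hK n hn)).trans_lt (half_lt_self hε)

/-- The finite part of an extended norm, as a type without the metric of `ℝ`. -/
def FinitePart (N : ℝ → ℝ≥0∞) : Type := {r : ℝ // N r ≠ ⊤}

/-- The metric induced by an extended norm on its finite part. -/
noncomputable abbrev metricSpace (hN : IsExtNorm N) : MetricSpace (FinitePart N) where
  dist r s := (N (r.1 - s.1)).toReal
  dist_self r := (hN.toReal_sub_eq_zero_iff r.2 r.2).2 rfl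
  dist_comm r s := by rw [hN.sub_comm]
  dist_triangle r s t := hN.toReal_triangle r.2 s.2 t.2
  eq_of_dist_eq_zero {r s} h := Subtype.ext ((hN.toReal_sub_eq_zero_iff r.2 s.2).1 h)

/-- By Baire's theorem, the finite part of a non-discrete extended norm is uncountable. -/
lemma not_countable (hN : IsExtNorm N)
    (hsmall : ∀ ε : ℝ, 0 < ε → ∃ s, s ≠ 0 ∧ N s ≠ ⊤ ∧ (N s).toReal < ε) :
    ¬ {r | N r ≠ ⊤}.Countable := by
  intro hcount
  let := hN.metricSpace
  have : Countable (FinitePart N) := hcount.to_subtype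
  have : Nonempty (FinitePart N) := ⟨⟨0, by simp [hN.map_zero]⟩⟩
  have hdist : ∀ r s : FinitePart N, dist r s = (N (r.1 - s.1)).toReal := fun _ _ => rfl
  have : CompleteSpace (FinitePart N) := by
    refine Metric.complete_of_cauchySeq_tendsto fun u hu => ?_
    rw [Metric.cauchySeq_iff] at hu
    obtain ⟨r, hr, hlim⟩ := hN.complete (fun n => (u n).1) (fun n => (u n).2) hu
    exact ⟨⟨r, hr⟩, tendsto_iff_dist_tendsto_zero.2 hlim⟩
  obtain ⟨r, hr⟩ := nonempty_interior_of_iUnion_of_closed (f := fun r : FinitePart N => {r})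
    (fun _ => isClosed_singleton) (iUnion_of_singleton _)
  obtain ⟨t, ht⟩ := hr
  obtain ⟨ε, hε, hball⟩ := Metric.isOpen_iff.1 isOpen_interior t ht
  obtain ⟨s, hs0, hs, hsε⟩ := hsmall ε hε
  let t' : FinitePart N := ⟨t.1 + s, hN.add_ne_top t.2 hs⟩
  have ht' : dist t' t < ε := by
    rw [hdist, show t'.1 - t.1 = s from add_sub_cancel_left _ _]
    exact hsε
  have h1 : t' = r := mem_singleton_iff.1 (interior_subset (hball ht'))
  have h2 : t = r := mem_singleton_iff.1 (interior_subset ht)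
  apply hs0
  have := congrArg Subtype.val (h1.trans h2.symm)
  simpa [t'] using this

lemma map_natCast_mul_le (hN : IsExtNorm N) (k : ℕ) (r : ℝ) : N (k * r) ≤ k * N r := by
  induction k with
  | zero => simp [hN.map_zero]
  | succ k ih =>
    push_cast
    rw [add_mul, add_mul, one_mul, one_mul]
    exact (hN.map_add_le _ _).trans (add_le_add_left ih _)

lemma map_intCast_mul_le (hN : IsExtNorm N) (k : ℤ) (r : ℝ) : N (k * r) ≤ k.natAbs * N r := by
  obtain ⟨n, rfl | rfl⟩ := k.eq_nat_or_neg
  · simpa using hN.map_natCast_mul_le n r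
  · simpa [hN.map_neg] using hN.map_natCast_mul_le n r

end IsExtNorm

lemma exists_toReal_lt_of_le_mul {C : ℝ≥0∞} (hC : C ≠ ⊤) {ε : ℝ} (hε : 0 < ε) :
    ∃ δ : ℝ, 0 < δ ∧ ∀ u v : ℝ≥0∞, v ≠ ⊤ → u ≤ C * v → v.toReal < δ → u.toReal < ε := by
  have hC0 : 0 ≤ C.toReal := ENNReal.toReal_nonneg
  refine ⟨ε / (C.toReal + 1), by positivity, fun u v hv huv hlt => ?_⟩
  have h := ENNReal.toReal_mono (ENNReal.mul_ne_top hC hv) huv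
  rw [ENNReal.toReal_mul] at h
  rw [lt_div_iff₀ (by positivity)] at hlt
  nlinarith [ENNReal.toReal_nonneg (a := v)]

/-- The distance from `a₀ ⋯ a_{n-1} r` to the nearest integer, scaled by `a_n` and capped. -/
noncomputable def cappedDist (a : ℕ → ℕ) (n : ℕ) (r : ℝ) : ℝ :=
  min 1 (a n * ‖((bProd a n * r : ℝ) : UnitAddCircle)‖)

/-- The extended norm `|r| + ∑ w_n · cappedDist a n r`. -/
noncomputable def weightedNorm (a : ℕ → ℕ) (w : ℕ → ℝ) (r : ℝ) : ℝ≥0∞ :=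
  ENNReal.ofReal |r| + ∑' n, ENNReal.ofReal (w n * cappedDist a n r)

section cappedDist

variable {a : ℕ → ℕ}

lemma bProd_succ (a : ℕ → ℕ) (n : ℕ) : bProd a (n + 1) = bProd a n * a n :=
  Finset.prod_range_succ _ _

lemma bProd_zero (a : ℕ → ℕ) : bProd a 0 = 1 := Finset.prod_range_zero _

lemma cappedDist_nonneg (a : ℕ → ℕ) (n : ℕ) (r : ℝ) : 0 ≤ cappedDist a n r := by
  unfold cappedDist; positivity

lemma cappedDist_le_one (a : ℕ → ℕ) (n : ℕ) (r : ℝ) : cappedDist a n r ≤ 1 := min_le_left _ _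

lemma cappedDist_neg (a : ℕ → ℕ) (n : ℕ) (r : ℝ) : cappedDist a n (-r) = cappedDist a n r := by
  simp [cappedDist]

lemma cappedDist_add_le (a : ℕ → ℕ) (n : ℕ) (r s : ℝ) :
    cappedDist a n (r + s) ≤ cappedDist a n r + cappedDist a n s := by
  have h : (a n : ℝ) * ‖((bProd a n * (r + s) : ℝ) : UnitAddCircle)‖ ≤
      a n * ‖((bProd a n * r : ℝ) : UnitAddCircle)‖ +
      a n * ‖((bProd a n * s : ℝ) : UnitAddCircle)‖ := by
    rw [mul_add (bProd a n), AddCircle.coe_add, ← mul_add]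
    exact mul_le_mul_of_nonneg_left (norm_add_le _ _) (Nat.cast_nonneg _)
  have h1 : 0 ≤ (a n : ℝ) * ‖((bProd a n * r : ℝ) : UnitAddCircle)‖ := by positivity
  have h2 : 0 ≤ (a n : ℝ) * ‖((bProd a n * s : ℝ) : UnitAddCircle)‖ := by positivity
  unfold cappedDist
  grind

lemma continuous_cappedDist (a : ℕ → ℕ) (n : ℕ) : Continuous (cappedDist a n) := by
  unfold cappedDist
  have : Continuous fun r : ℝ => ((bProd a n * r : ℝ) : UnitAddCircle) :=
    (AddCircle.continuous_mk' 1).comp (continuous_const.mul continuous_id)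
  exact continuous_const.min (continuous_const.mul this.norm)

lemma bProd_pos (ha : ∀ n, 2 ≤ a n) (n : ℕ) : 0 < bProd a n :=
  Finset.prod_pos fun k _ => by have := ha k; positivity

lemma norm_coe_le_abs (t : ℝ) : ‖(t : UnitAddCircle)‖ ≤ |t| := by
  rw [UnitAddCircle.norm_eq]
  simpa using round_le t 0

lemma norm_coe_eq_abs {t : ℝ} (ht : |t| ≤ 1 / 2) : ‖(t : UnitAddCircle)‖ = |t| :=
  (AddCircle.norm_coe_eq_abs_iff 1 one_ne_zero).2 (by simpa using ht)

lemma norm_coe_add_int (t : ℝ) (k : ℤ) :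
    ‖((t + k : ℝ) : UnitAddCircle)‖ = ‖(t : UnitAddCircle)‖ := by
  simp [UnitAddCircle.norm_eq]

lemma cappedDist_le_abs (ha : ∀ n, 2 ≤ a n) (n : ℕ) (r : ℝ) :
    cappedDist a n r ≤ bProd a (n + 1) * |r| := by
  refine (min_le_right _ _).trans ?_
  rw [bProd_succ, mul_comm (bProd a n) (a n : ℝ), mul_assoc]
  refine mul_le_mul_of_nonneg_left ((norm_coe_le_abs _).trans ?_) (Nat.cast_nonneg _)
  rw [abs_mul, abs_of_pos (bProd_pos ha n)]

lemma cappedDist_add_of_int {n : ℕ} {s : ℝ} (r : ℝ) (hs : ∃ k : ℤ, bProd a n * s = k) :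
    cappedDist a n (r + s) = cappedDist a n r := by
  obtain ⟨k, hk⟩ := hs
  unfold cappedDist
  rw [mul_add, hk, norm_coe_add_int]

lemma cappedDist_zero (a : ℕ → ℕ) (n : ℕ) : cappedDist a n 0 = 0 := by simp [cappedDist]

lemma cappedDist_of_int {n : ℕ} {s : ℝ} (hs : ∃ k : ℤ, bProd a n * s = k) :
    cappedDist a n s = 0 := by
  simpa [cappedDist_zero] using cappedDist_add_of_int 0 hs

lemma cappedDist_div_le (n : ℕ) (r : ℝ) {d : ℕ} (hd : 0 < d) (hda : d ∣ a n) :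
    cappedDist a (n + 1) (r / d) ≤ cappedDist a (n + 1) r + 2 * cappedDist a n r := by
  obtain ⟨e, he⟩ := hda
  have hd' : (1 : ℝ) ≤ d := by exact_mod_cast hd
  have hd0 : (d : ℝ) ≠ 0 := by positivity
  set t := bProd a n * r with ht
  set ε := t - round t with hε
  have hnorm : ‖(t : UnitAddCircle)‖ = |ε| := UnitAddCircle.norm_eq
  have hq : bProd a (n + 1) * (r / d) = e * ε + ((e * round t : ℤ) : ℝ) := by
    rw [bProd_succ, he]; push_cast; field_simp; rw [hε, ht]; ring
  have hr : bProd a (n + 1) * r = a n * ε + ((a n * round t : ℤ) : ℝ) := by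
    rw [bProd_succ]; push_cast; rw [hε, ht]; ring
  have h0 := cappedDist_nonneg a n r
  have h1 := cappedDist_nonneg a (n + 1) r
  by_cases hsmall : (a n : ℝ) * |ε| ≤ 1 / 2
  · have h2 : cappedDist a (n + 1) (r / d) ≤ cappedDist a (n + 1) r := by
      unfold cappedDist
      rw [hq, hr, norm_coe_add_int, norm_coe_add_int]
      refine min_le_min le_rfl (mul_le_mul_of_nonneg_left ?_ (Nat.cast_nonneg _))
      rw [norm_coe_eq_abs (t := a n * ε) (by rwa [abs_mul, Nat.abs_cast])]
      refine (norm_coe_le_abs _).trans ?_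
      rw [abs_mul, abs_mul, Nat.abs_cast, Nat.abs_cast, he]
      refine mul_le_mul_of_nonneg_right ?_ (abs_nonneg _)
      exact_mod_cast Nat.le_mul_of_pos_left e hd
    linarith
  · have h2 : 1 / 2 ≤ cappedDist a n r := by
      unfold cappedDist
      rw [← ht, hnorm]
      exact le_min (by norm_num) (not_le.1 hsmall).le
    linarith [cappedDist_le_one a (n + 1) (r / d)]

lemma sum_bProd_le (ha : ∀ n, 2 ≤ a n) (m : ℕ) :
    ∑ n ∈ Finset.range m, bProd a (n + 1) ≤ 2 * bProd a m := by
  induction m with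
  | zero => simp [bProd_zero]
  | succ m ih =>
    rw [Finset.sum_range_succ]
    have h2 : (2 : ℝ) ≤ a m := by exact_mod_cast ha m
    have := mul_le_mul_of_nonneg_left h2 (bProd_pos ha m).le
    rw [← bProd_succ] at this
    linarith

lemma bProd_mul_div_int (ha : ∀ n, 2 ≤ a n) {m n : ℕ} (h : m ≤ n) (k : ℤ) :
    ∃ l : ℤ, bProd a n * (k / bProd a m) = l := by
  refine ⟨(∏ i ∈ Finset.Ico m n, (a i : ℤ)) * k, ?_⟩
  have := bProd_pos ha m
  have h1 : bProd a n = bProd a m * ∏ i ∈ Finset.Ico m n, (a i : ℝ) :=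
    (Finset.prod_range_mul_prod_Ico _ h).symm
  rw [h1]
  push_cast
  field_simp

end cappedDist

section weightedNorm

variable {a : ℕ → ℕ} {w : ℕ → ℝ}

lemma weightedNorm_isExtNorm (a : ℕ → ℕ) (hw : ∀ n, 0 ≤ w n) : IsExtNorm (weightedNorm a w) where
  map_zero := by simp [weightedNorm, cappedDist_zero]
  map_neg r := by simp [weightedNorm, cappedDist_neg]
  map_add_le r s := by
    unfold weightedNorm
    rw [add_add_add_comm, ← ENNReal.tsum_add]
    refine add_le_add ?_ (ENNReal.tsum_le_tsum fun n => ?_)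
    · rw [← ENNReal.ofReal_add (abs_nonneg _) (abs_nonneg _)]
      exact ENNReal.ofReal_le_ofReal (abs_add_le r s)
    · rw [← ENNReal.ofReal_add (mul_nonneg (hw n) (cappedDist_nonneg a n r))
        (mul_nonneg (hw n) (cappedDist_nonneg a n s)), ← mul_add]
      exact ENNReal.ofReal_le_ofReal
        (mul_le_mul_of_nonneg_left (cappedDist_add_le a n r s) (hw n))
  abs_le r := le_self_add
  lsc := by
    refine LowerSemicontinuous.add
      (ENNReal.continuous_ofReal.comp continuous_abs).lowerSemicontinuous
      (lowerSemicontinuous_tsum fun n => ?_)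
    exact (ENNReal.continuous_ofReal.comp
      (continuous_const.mul (continuous_cappedDist a n))).lowerSemicontinuous

lemma ofReal_le_weightedNorm (a : ℕ → ℕ) (w : ℕ → ℝ) (n : ℕ) (r : ℝ) :
    ENNReal.ofReal (w n * cappedDist a n r) ≤ weightedNorm a w r :=
  (ENNReal.le_tsum n).trans le_add_self

lemma weightedNorm_le_mul {w' : ℕ → ℝ} {C : ℝ} (hC : 1 ≤ C) (h : ∀ n, w' n ≤ C * w n) (r : ℝ) :
    weightedNorm a w' r ≤ ENNReal.ofReal C * weightedNorm a w r := by
  have hC0 : 0 ≤ C := zero_le_one.trans hC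
  unfold weightedNorm
  rw [mul_add, ← ENNReal.tsum_mul_left]
  refine add_le_add ?_ (ENNReal.tsum_le_tsum fun n => ?_)
  · rw [← ENNReal.ofReal_mul hC0]
    exact ENNReal.ofReal_le_ofReal (le_mul_of_one_le_left (abs_nonneg r) hC)
  · rw [← ENNReal.ofReal_mul hC0, ← mul_assoc]
    exact ENNReal.ofReal_le_ofReal (mul_le_mul_of_nonneg_right (h n) (cappedDist_nonneg a n r))

lemma weightedNorm_int_div (ha : ∀ n, 2 ≤ a n) (w : ℕ → ℝ) (k : ℤ) (m : ℕ) :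
    weightedNorm a w (k / bProd a m) = ENNReal.ofReal |k / bProd a m| +
      ∑ n ∈ Finset.range m, ENNReal.ofReal (w n * cappedDist a n (k / bProd a m)) := by
  unfold weightedNorm
  rw [tsum_eq_sum fun n hn => ?_]
  rw [cappedDist_of_int (bProd_mul_div_int ha (by simpa using hn) k)]
  simp

lemma weightedNorm_int_div_ne_top (ha : ∀ n, 2 ≤ a n) (w : ℕ → ℝ) (k : ℤ) (m : ℕ) :
    weightedNorm a w (k / bProd a m) ≠ ⊤ := by
  rw [weightedNorm_int_div ha]
  exact ENNReal.add_ne_top.2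
    ⟨ENNReal.ofReal_ne_top, ENNReal.sum_ne_top.2 fun _ _ => ENNReal.ofReal_ne_top⟩

lemma one_le_bProd (ha : ∀ n, 2 ≤ a n) (n : ℕ) : 1 ≤ bProd a n := by
  induction n with
  | zero => rw [bProd_zero]
  | succ n ih =>
    rw [bProd_succ]
    exact one_le_mul_of_one_le_of_one_le ih (by exact_mod_cast one_le_two.trans (ha n))

lemma sum_cappedDist_le (ha : ∀ n, 2 ≤ a n) (hw : ∀ n, 0 ≤ w n) (hw1 : ∀ n, w n ≤ 1)
    (m : ℕ) (s : ℝ) :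
    ∑ n ∈ Finset.range m, ENNReal.ofReal (w n * cappedDist a n s) ≤
      ENNReal.ofReal (2 * (bProd a m * |s|)) := by
  rw [← ENNReal.ofReal_sum_of_nonneg fun n _ => mul_nonneg (hw n) (cappedDist_nonneg a n s)]
  refine ENNReal.ofReal_le_ofReal ?_
  calc ∑ n ∈ Finset.range m, w n * cappedDist a n s
      ≤ ∑ n ∈ Finset.range m, bProd a (n + 1) * |s| := Finset.sum_le_sum fun n _ =>
        (mul_le_of_le_one_left (cappedDist_nonneg a n s) (hw1 n)).trans (cappedDist_le_abs ha n s)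
    _ ≤ 2 * (bProd a m * |s|) := by
        rw [← Finset.sum_mul, ← mul_assoc]
        exact mul_le_mul_of_nonneg_right (sum_bProd_le ha m) (abs_nonneg s)

lemma weightedNorm_inv_bProd_le (ha : ∀ n, 2 ≤ a n) (hw : ∀ n, 0 ≤ w n) (hw1 : ∀ n, w n ≤ 1)
    (m : ℕ) :
    weightedNorm a w (1 / bProd a (m + 1)) ≤ ENNReal.ofReal (w m + 3 / a m) := by
  have h := weightedNorm_int_div ha w 1 (m + 1)
  rw [Int.cast_one] at h
  have hb := bProd_pos ha m
  have hb1 := one_le_bProd ha m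
  have ham : (0 : ℝ) < a m := by have := ha m; positivity
  have habs : |1 / bProd a (m + 1)| = 1 / (bProd a m * a m) := by
    rw [bProd_succ, abs_of_pos (by positivity)]
  have h1 : 1 / (bProd a m * a m) ≤ 1 / a m :=
    one_div_le_one_div_of_le ham (le_mul_of_one_le_left ham.le hb1)
  rw [h, Finset.sum_range_succ]
  calc _ ≤ ENNReal.ofReal (1 / a m) + (ENNReal.ofReal (2 / a m) + ENNReal.ofReal (w m)) := by
        refine add_le_add (ENNReal.ofReal_le_ofReal (habs.trans_le h1)) (add_le_add ?_ ?_)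
        · refine (sum_cappedDist_le ha hw hw1 m _).trans (ENNReal.ofReal_le_ofReal ?_)
          rw [habs]
          field_simp
          rfl
        · exact ENNReal.ofReal_le_ofReal
            (mul_le_of_le_one_right (hw m) (cappedDist_le_one _ _ _))
    _ = ENNReal.ofReal (w m + 3 / a m) := by
        have := hw m
        rw [← ENNReal.ofReal_add (by positivity) (by positivity),
          ← ENNReal.ofReal_add (by positivity) (by positivity)]
        congr 1
        ring

lemma exists_weightedNorm_sub_lt (ha : ∀ n, 2 ≤ a n) (hw : ∀ n, 0 ≤ w n) (hw1 : ∀ n, w n ≤ 1)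
    (hfreq : ∃ᶠ n in atTop, w n = 1) {r : ℝ} (hr : weightedNorm a w r ≠ ⊤) {ε : ℝ≥0∞}
    (hε : 0 < ε) : ∃ (k : ℤ) (m : ℕ), weightedNorm a w (r - k / bProd a m) < ε := by
  set e : ℕ → ℝ≥0∞ := fun n => ENNReal.ofReal (w n * cappedDist a n r) with he
  have hsum : ∑' n, e n ≠ ⊤ := ne_top_of_le_ne_top hr le_add_self
  have htail : Tendsto (fun m => 4 * ∑' n, e (n + m)) atTop (nhds 0) := by
    simpa using ENNReal.Tendsto.const_mul (ENNReal.tendsto_sum_nat_add e hsum)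
      (Or.inr (by norm_num : (4 : ℝ≥0∞) ≠ ⊤))
  obtain ⟨m, hwm, hm⟩ := (hfreq.and_eventually (htail.eventually_lt_const hε)).exists
  refine ⟨round (bProd a m * r), m, lt_of_le_of_lt ?_ hm⟩
  have hb := bProd_pos ha m
  set k := round (bProd a m * r)
  set s := r - k / bProd a m with hs
  set β := bProd a m * |s| with hβ
  have hβ0 : 0 ≤ β := by positivity
  have hβnorm : ‖((bProd a m * r : ℝ) : UnitAddCircle)‖ = β := by
    rw [UnitAddCircle.norm_eq, hβ, ← abs_of_pos hb, ← abs_mul, abs_of_pos hb, hs, mul_sub,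
      mul_div_cancel₀ _ hb.ne']
  have hβhalf : β ≤ 1 / 2 := by
    rw [← hβnorm, UnitAddCircle.norm_eq]
    exact abs_sub_round _
  have hβe : ENNReal.ofReal β ≤ ∑' n, e (n + m) := by
    refine le_trans ?_ (ENNReal.le_tsum 0)
    rw [he]
    refine ENNReal.ofReal_le_ofReal ?_
    rw [zero_add, hwm, one_mul, cappedDist, hβnorm]
    have : (1 : ℝ) ≤ a m := by exact_mod_cast one_le_two.trans (ha m)
    exact le_min (by linarith) (le_mul_of_one_le_left hβ0 this)
  have hsβ : |s| ≤ β := le_mul_of_one_le_left (abs_nonneg s) (one_le_bProd ha m)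
  have htail_eq : ∀ n, ENNReal.ofReal (w (n + m) * cappedDist a (n + m) s) = e (n + m) := by
    intro n
    obtain ⟨l, hl⟩ := bProd_mul_div_int ha (Nat.le_add_left m n) (-k)
    rw [he, hs, sub_eq_add_neg, cappedDist_add_of_int]
    exact ⟨l, by rw [← hl]; push_cast; ring⟩
  have hsplit := ENNReal.summable.sum_add_tsum_nat_add' (f := fun n =>
    ENNReal.ofReal (w n * cappedDist a n s)) (k := m)
  unfold weightedNorm
  rw [← hsplit]
  simp only [htail_eq]
  calc _ ≤ ENNReal.ofReal β + (ENNReal.ofReal (2 * β) + ∑' n, e (n + m)) :=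
        add_le_add (ENNReal.ofReal_le_ofReal hsβ)
          (add_le_add_left (sum_cappedDist_le ha hw hw1 m s) _)
    _ = 3 * ENNReal.ofReal β + ∑' n, e (n + m) := by
        rw [ENNReal.ofReal_mul zero_le_two, ENNReal.ofReal_ofNat]
        ring
    _ ≤ 3 * (∑' n, e (n + m)) + ∑' n, e (n + m) := by gcongr
    _ = 4 * ∑' n, e (n + m) := by ring

lemma exists_weightedNorm_div_le (ha : ∀ n, 2 ≤ a n) (hw : ∀ n, 0 ≤ w n) (hw1 : ∀ n, w n ≤ 1)
    (hw2 : ∀ n, w (n + 1) ≤ 2 * w n) {d : ℕ} (hd : 0 < d) (hda : ∀ᶠ n in atTop, d ∣ a n) :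
    ∃ C : ℝ≥0∞, C ≠ ⊤ ∧ ∀ r, weightedNorm a w (r / d) ≤ C * weightedNorm a w r := by
  obtain ⟨K, hK⟩ := eventually_atTop.1 hda
  set A : ℝ≥0∞ := ∑ n ∈ Finset.range (K + 1), ENNReal.ofReal (bProd a (n + 1)) with hA
  refine ⟨6 + A, ENNReal.add_ne_top.2 ⟨by norm_num, ENNReal.sum_ne_top.2 fun _ _ =>
    ENNReal.ofReal_ne_top⟩, fun r => ?_⟩
  set e : ℕ → ℝ≥0∞ := fun n => ENNReal.ofReal (w n * cappedDist a n r) with he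
  have hdr : |r / d| ≤ |r| := by
    rw [abs_div, Nat.abs_cast]
    exact div_le_self (abs_nonneg r) (by exact_mod_cast hd)
  have hinit : ∀ n, ENNReal.ofReal (w n * cappedDist a n (r / d)) ≤
      ENNReal.ofReal (bProd a (n + 1)) * ENNReal.ofReal |r| := by
    intro n
    rw [← ENNReal.ofReal_mul (bProd_pos ha _).le]
    refine ENNReal.ofReal_le_ofReal ?_
    refine (mul_le_of_le_one_left (cappedDist_nonneg a n _) (hw1 n)).trans
      ((cappedDist_le_abs ha n _).trans ?_)
    exact mul_le_mul_of_nonneg_left hdr (bProd_pos ha _).le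
  have hlate : ∀ n, ENNReal.ofReal (w (n + (K + 1)) * cappedDist a (n + (K + 1)) (r / d)) ≤
      e (n + (K + 1)) + 4 * e (n + K) := by
    intro n
    have h1 := cappedDist_div_le (n + K) r hd (hK (n + K) (Nat.le_add_left K n))
    have h2 := cappedDist_nonneg a (n + K) r
    have h3 := cappedDist_nonneg a (n + K + 1) r
    have h4 := hw (n + K)
    have h5 := hw (n + K + 1)
    have h6 := hw2 (n + K)
    simp only [he, ← add_assoc]
    rw [← ENNReal.ofReal_ofNat 4, ← ENNReal.ofReal_mul (by norm_num),
      ← ENNReal.ofReal_add (mul_nonneg h5 h3) (by positivity)]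
    refine ENNReal.ofReal_le_ofReal ?_
    nlinarith [mul_le_mul_of_nonneg_left h1 h5, mul_le_mul_of_nonneg_right h6 h2]
  have hshift : ∀ j, ∑' n, e (n + j) ≤ ∑' n, e n := fun j =>
    ENNReal.tsum_comp_le_tsum_of_injective (add_left_injective j) e
  have hsplit := ENNReal.summable.sum_add_tsum_nat_add' (f := fun n =>
    ENNReal.ofReal (w n * cappedDist a n (r / d))) (k := K + 1)
  unfold weightedNorm
  rw [← hsplit]
  calc _ ≤ ENNReal.ofReal |r| + (A * ENNReal.ofReal |r| + (∑' n, e n + 4 * ∑' n, e n)) := by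
        refine add_le_add (ENNReal.ofReal_le_ofReal hdr) (add_le_add ?_ ?_)
        · rw [hA, Finset.sum_mul]
          exact Finset.sum_le_sum fun n _ => hinit n
        · refine (ENNReal.tsum_le_tsum hlate).trans ?_
          rw [ENNReal.tsum_add, ENNReal.tsum_mul_left]
          exact add_le_add (hshift _) (mul_le_mul_right (hshift _) _)
    _ = (1 + A) * ENNReal.ofReal |r| + 5 * ∑' n, e n := by ring
    _ ≤ (6 + A) * ENNReal.ofReal |r| + (6 + A) * ∑' n, e n := by
        gcongr
        · norm_num
        · exact le_add_of_le_left (by norm_num)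
    _ = _ := (mul_add _ _ _).symm

lemma exists_weightedNorm_ratCast_mul_le (ha : ∀ n, 2 ≤ a n) (hw : ∀ n, 0 ≤ w n)
    (hw1 : ∀ n, w n ≤ 1) (hw2 : ∀ n, w (n + 1) ≤ 2 * w n) (q : ℚ)
    (hq : ∀ᶠ n in atTop, q.den ∣ a n) :
    ∃ C : ℝ≥0∞, C ≠ ⊤ ∧ ∀ r, weightedNorm a w (q * r) ≤ C * weightedNorm a w r := by
  obtain ⟨C, hC, h⟩ := exists_weightedNorm_div_le ha hw hw1 hw2 q.den_pos hq
  refine ⟨q.num.natAbs * C, ENNReal.mul_ne_top (ENNReal.natCast_ne_top _) hC, fun r => ?_⟩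
  have hqr : (q : ℝ) * r = q.num * (r / q.den) := by
    rw [Rat.cast_def]; ring
  rw [hqr, mul_assoc]
  exact ((weightedNorm_isExtNorm a hw).map_intCast_mul_le _ _).trans
    (mul_le_mul_right (h r) _)

end weightedNorm

/-- On each block `[2 ^ k, 2 ^ (k + 1))` with `k` even or `k / 2 ∈ x`, the weight jumps to
`2⁻ᵏ` and then doubles at every step until it reaches `1`; elsewhere it is `1`. -/
noncomputable def blockWeight (x : Set ℕ) (n : ℕ) : ℝ :=
  open scoped Classical in
  if Even (Nat.log 2 n) ∨ Nat.log 2 n / 2 ∈ x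
  then (1 / 2) ^ (2 ^ Nat.log 2 n + Nat.log 2 n - n) else 1

section blockWeight

lemma blockWeight_pos (x : Set ℕ) (n : ℕ) : 0 < blockWeight x n := by
  unfold blockWeight; split_ifs <;> positivity

lemma blockWeight_le_one (x : Set ℕ) (n : ℕ) : blockWeight x n ≤ 1 := by
  unfold blockWeight
  split_ifs
  · exact pow_le_one₀ (by norm_num) (by norm_num)
  · rfl

lemma blockWeight_succ_le (x : Set ℕ) (n : ℕ) : blockWeight x (n + 1) ≤ 2 * blockWeight x n := by
  by_cases hlog : Nat.log 2 (n + 1) = Nat.log 2 n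
  · unfold blockWeight
    rw [hlog]
    split_ifs
    · rw [← div_le_iff₀' two_pos, div_eq_mul_one_div, ← pow_succ]
      exact pow_le_pow_of_le_one (by norm_num) (by norm_num) (by omega)
    · norm_num
  · have hlt : Nat.log 2 n < Nat.log 2 (n + 1) :=
      lt_of_le_of_ne (Nat.log_mono_right n.le_succ) (Ne.symm hlog)
    have hpow : 2 ^ (Nat.log 2 n + 1) ≤ n + 1 :=
      (Nat.pow_le_pow_right two_pos hlt).trans (Nat.pow_log_le_self 2 n.succ_ne_zero)
    have hk : Nat.log 2 n < 2 ^ Nat.log 2 n := Nat.lt_two_pow_self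
    have hexp : 2 ^ Nat.log 2 n + Nat.log 2 n - n = 0 := by rw [pow_succ] at hpow; omega
    have h1 : blockWeight x n = 1 := by unfold blockWeight; rw [hexp]; simp
    linarith [blockWeight_le_one x (n + 1)]

lemma frequently_blockWeight_eq_one (x : Set ℕ) : ∃ᶠ n in atTop, blockWeight x n = 1 := by
  rw [frequently_atTop]
  intro K
  have hK : K < 2 ^ K := Nat.lt_two_pow_self
  have hlog : Nat.log 2 (2 ^ K + K) = K := by
    rw [Nat.log_eq_iff (by omega), pow_succ]
    omega
  exact ⟨2 ^ K + K, by omega, by unfold blockWeight; rw [hlog]; simp⟩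

lemma blockWeight_two_pow_of_mem {x : Set ℕ} {k : ℕ} (hk : Even k ∨ k / 2 ∈ x) :
    blockWeight x (2 ^ k) = (1 / 2) ^ k := by
  simp [blockWeight, Nat.log_pow, hk]

lemma blockWeight_two_pow_of_notMem {x : Set ℕ} {j : ℕ} (hj : j ∉ x) :
    blockWeight x (2 ^ (2 * j + 1)) = 1 := by
  have h : (2 * j + 1) / 2 = j := by omega
  simp [blockWeight, Nat.log_pow, h, hj]

lemma exists_blockWeight_le {x y : Set ℕ} (h : (x \ y).Finite) :
    ∃ C : ℝ, 1 ≤ C ∧ ∀ n, blockWeight y n ≤ C * blockWeight x n := by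
  obtain ⟨K, hK⟩ := h.bddAbove
  refine ⟨2 ^ (2 * K + 1), one_le_pow₀ one_le_two, fun n => ?_⟩
  have hC : (1 : ℝ) ≤ 2 ^ (2 * K + 1) := one_le_pow₀ one_le_two
  by_cases hx : Even (Nat.log 2 n) ∨ Nat.log 2 n / 2 ∈ x
  · by_cases hy : Even (Nat.log 2 n) ∨ Nat.log 2 n / 2 ∈ y
    · have : blockWeight y n = blockWeight x n := by simp [blockWeight, hx, hy]
      rw [this]
      exact le_mul_of_one_le_left (blockWeight_pos x n).le hC
    · have hmem : Nat.log 2 n / 2 ≤ K := hK ⟨by tauto, by tauto⟩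
      refine (blockWeight_le_one y n).trans ?_
      rw [blockWeight, if_pos hx, one_div, inv_pow, ← div_eq_mul_inv,
        le_div_iff₀ (by positivity), one_mul]
      refine pow_le_pow_right₀ one_le_two ?_
      rcases n.eq_zero_or_pos with rfl | hn
      · simp
      · have : n < 2 ^ (Nat.log 2 n + 1) := Nat.lt_pow_succ_log_self one_lt_two n
        have := Nat.pow_log_le_self 2 hn.ne'
        omega
  · have : blockWeight x n = 1 := by rw [blockWeight, if_neg hx]
    rw [this, mul_one]
    exact (blockWeight_le_one y n).trans hC

end blockWeight

lemma inv_den_mem (R : Subring ℚ) {q : ℚ} (hq : q ∈ R) : (q.den : ℚ)⁻¹ ∈ R := by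
  have hcop : IsCoprime q.num (q.den : ℤ) := Rat.isCoprime_num_den q
  obtain ⟨u, v, huv⟩ := hcop
  have hden : (q.den : ℚ) ≠ 0 := by exact_mod_cast q.den_ne_zero
  have h : (q.den : ℚ)⁻¹ = u * q + v := by
    have huv' : (u : ℚ) * q.num + v * q.den = 1 := by exact_mod_cast huv
    nth_rewrite 2 [← Rat.num_div_den q]
    field_simp
    linarith
  rw [h]
  exact R.add_mem (R.mul_mem (intCast_mem R u) hq) (intCast_mem R v)

lemma exists_base (R : Subring ℚ) (hR : (R : Set ℚ) ≠ Set.range (Int.cast : ℤ → ℚ)) :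
    ∃ a : ℕ → ℕ, (∀ n, 2 ^ (n + 1) ≤ a n) ∧ (∀ n, (a n : ℚ)⁻¹ ∈ R) ∧
      ∀ q ∈ R, ∀ᶠ n in atTop, q.den ∣ a n := by
  classical
  obtain ⟨q, hq, hqint⟩ : ∃ q ∈ R, q.den ≠ 1 := by
    by_contra! hall
    refine hR (Set.Subset.antisymm (fun q hq => ⟨q.num, ?_⟩) ?_)
    · exact Rat.coe_int_num_of_den_eq_one (hall q hq)
    · rintro _ ⟨k, rfl⟩
      exact intCast_mem R k
  have hd : 2 ≤ q.den := by have := q.den_pos; omega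
  let S : ℕ → Finset ℕ := fun n => {d ∈ Finset.range (n + 1) | d ≠ 0 ∧ (d : ℚ)⁻¹ ∈ R}
  refine ⟨fun n => q.den ^ (n + 1) * ∏ d ∈ S n, d, fun n => ?_, fun n => ?_, fun s hs => ?_⟩
  · refine (Nat.pow_le_pow_left hd (n + 1)).trans (Nat.le_mul_of_pos_right _ ?_)
    exact Finset.prod_pos fun d hd => Nat.pos_of_ne_zero (Finset.mem_filter.1 hd).2.1
  · push_cast
    rw [mul_inv, ← inv_pow, ← Finset.prod_inv_distrib]
    exact R.mul_mem (R.pow_mem (inv_den_mem R hq) _)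
      (R.prod_mem fun d hd => (Finset.mem_filter.1 hd).2.2)
  · filter_upwards [eventually_ge_atTop s.den] with n hn
    refine Dvd.dvd.mul_left (Finset.dvd_prod_of_mem (fun d => d) ?_) _
    exact Finset.mem_filter.2 ⟨Finset.mem_range.2 (by omega), s.den_ne_zero, inv_den_mem R hs⟩

lemma exists_bProd_eq (R : Subring ℚ) {a : ℕ → ℕ} (ha : ∀ n, (a n : ℚ)⁻¹ ∈ R) (k : ℤ) (m : ℕ) :
    ∃ q ∈ R, (q : ℝ) = k / bProd a m := by
  refine ⟨k * ∏ n ∈ Finset.range m, (a n : ℚ)⁻¹,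
    R.mul_mem (intCast_mem R k) (R.prod_mem fun n _ => ha n), ?_⟩
  simp [bProd, div_eq_mul_inv]

lemma exists_weightedNorm_inv_bProd_lt {a : ℕ → ℕ} (ha : ∀ n, 2 ^ (n + 1) ≤ a n) {x : Set ℕ}
    {K : Set ℕ} (hK : K.Infinite) (hKx : ∀ k ∈ K, Even k ∨ k / 2 ∈ x) {ε : ℝ} (hε : 0 < ε)
    (k₀ : ℕ) : ∃ k ∈ K, k₀ ≤ k ∧
      (weightedNorm a (blockWeight x) (1 / bProd a (2 ^ k + 1))).toReal < ε := by
  obtain ⟨k₁, hk₁⟩ := exists_pow_lt_of_lt_one (show 0 < ε / 4 by positivity)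
    (show (1 / 2 : ℝ) < 1 by norm_num)
  obtain ⟨k, hkK, hk⟩ := hK.exists_gt (max k₀ k₁)
  have ha2 : ∀ n, 2 ≤ a n := fun n => (Nat.le_self_pow n.succ_ne_zero 2).trans (ha n)
  refine ⟨k, hkK, (le_max_left _ _).trans hk.le, ?_⟩
  have h := weightedNorm_inv_bProd_le ha2 (fun n => (blockWeight_pos x n).le)
    (blockWeight_le_one x) (2 ^ k)
  have hle : (2 : ℝ) ^ k ≤ a (2 ^ k) := by
    have : 2 ^ k ≤ a (2 ^ k) := (Nat.pow_le_pow_right two_pos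
      (Nat.lt_two_pow_self.le.trans (Nat.le_succ _))).trans (ha (2 ^ k))
    exact_mod_cast this
  have hinv : 1 / (a (2 ^ k) : ℝ) ≤ (1 / 2) ^ k := by
    rw [one_div_pow]
    exact one_div_le_one_div_of_le (by positivity) hle
  have hpow : (1 / 2 : ℝ) ^ k ≤ (1 / 2) ^ k₁ :=
    pow_le_pow_of_le_one (by norm_num) (by norm_num) ((le_max_right _ _).trans hk.le)
  rw [blockWeight_two_pow_of_mem (hKx k hkK)] at h
  refine (ENNReal.toReal_le_of_le_ofReal (by positivity) h).trans_lt ?_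
  rw [div_eq_mul_one_div 3]
  linarith

lemma min_one_abs_le_cappedDist {a : ℕ → ℕ} (ha : ∀ n, 2 ≤ a n) {α : ℝ} {n : ℕ}
    (hα : 2 * |α| ≤ a n) : min 1 |α| ≤ cappedDist a n (1 / bProd a (n + 1) * α) := by
  have hb := bProd_pos ha n
  have han : (0 : ℝ) < a n := by have := ha n; positivity
  have h1 : bProd a n * (1 / bProd a (n + 1) * α) = α / a n := by
    rw [bProd_succ]
    field_simp
  have h2 : |α / a n| = |α| / a n := by rw [abs_div, Nat.abs_cast]
  rw [cappedDist, h1, norm_coe_eq_abs, h2, mul_div_cancel₀ _ han.ne']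
  rw [h2, div_le_iff₀ han]
  linarith

/-- Theorem B: for a subring `R` of ℚ with `R ≠ ℤ`, there is a family
`V x`, `x ⊆ ℕ`, of uncountable Fσ `R`-submodules of ℝ, each carrying a Polish topology
(given here by a complete separable metric `d x` on `V x`) refining the topology from ℝ
and making the module operations continuous, such that if `x \ y` is finite then
`V x ⊆ V y` with continuous inclusion, while if `x \ y` is infinite then every continuous
`R`-module homomorphism `V x → V y` is zero. -/
theorem theorem_B (R : Subring ℚ)
    (hR : (R : Set ℚ) ≠ Set.range (Int.cast : ℤ → ℚ)) :
    ∃ (V : Set ℕ → Set ℝ) (d : Set ℕ → ℝ → ℝ → ℝ),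
      -- each `V x` is uncountable
      (∀ x : Set ℕ, ¬ (V x).Countable) ∧
      -- each `V x` is a countable union of closed subsets of ℝ
      (∀ x : Set ℕ, ∃ C : ℕ → Set ℝ, (∀ k, IsClosed (C k)) ∧ V x = ⋃ k, C k) ∧
      -- each `V x` is an `R`-submodule of ℝ
      (∀ x : Set ℕ, (0 : ℝ) ∈ V x ∧
        (∀ r ∈ V x, ∀ s ∈ V x, r + s ∈ V x) ∧
        (∀ r ∈ V x, -r ∈ V x) ∧
        (∀ q : ℚ, q ∈ R → ∀ r ∈ V x, (q : ℝ) * r ∈ V x)) ∧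
      -- `d x` is a metric on `V x`, defining the topology `τ x`
      (∀ x : Set ℕ,
        (∀ r ∈ V x, ∀ s ∈ V x, 0 ≤ d x r s) ∧
        (∀ r ∈ V x, ∀ s ∈ V x, (d x r s = 0 ↔ r = s)) ∧
        (∀ r ∈ V x, ∀ s ∈ V x, d x r s = d x s r) ∧
        (∀ r ∈ V x, ∀ s ∈ V x, ∀ t ∈ V x, d x r t ≤ d x r s + d x s t)) ∧
      -- `(V x, τ x)` is Polish: the metric `d x` is complete ...
      (∀ x : Set ℕ, ∀ u : ℕ → ℝ, (∀ n, u n ∈ V x) →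
        (∀ ε : ℝ, 0 < ε → ∃ N : ℕ, ∀ m ≥ N, ∀ n ≥ N, d x (u m) (u n) < ε) →
        ∃ r ∈ V x, Filter.Tendsto (fun n => d x (u n) r) Filter.atTop (nhds 0)) ∧
      -- ... and separable
      (∀ x : Set ℕ, ∃ D : Set ℝ, D.Countable ∧ D ⊆ V x ∧
        ∀ r ∈ V x, ∀ ε : ℝ, 0 < ε → ∃ s ∈ D, d x r s < ε) ∧
      -- `(V x, τ x)` is a topological additive group: addition is continuous ...
      (∀ x : Set ℕ, ∀ r ∈ V x, ∀ s ∈ V x, ∀ ε : ℝ, 0 < ε →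
        ∃ δ : ℝ, 0 < δ ∧ ∀ r' ∈ V x, ∀ s' ∈ V x,
          d x r r' < δ → d x s s' < δ → d x (r + s) (r' + s') < ε) ∧
      -- ... and negation is continuous
      (∀ x : Set ℕ, ∀ r ∈ V x, ∀ ε : ℝ, 0 < ε → ∃ δ : ℝ, 0 < δ ∧
        ∀ s ∈ V x, d x r s < δ → d x (-r) (-s) < ε) ∧
      -- scalar multiplication by each fixed element of `R` is continuous
      (∀ x : Set ℕ, ∀ q : ℚ, q ∈ R → ∀ r ∈ V x, ∀ ε : ℝ, 0 < ε →
        ∃ δ : ℝ, 0 < δ ∧ ∀ s ∈ V x,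
          d x r s < δ → d x ((q : ℝ) * r) ((q : ℝ) * s) < ε) ∧
      -- `τ x` refines the topology inherited from ℝ (so the inclusion `V x → ℝ`
      -- is a continuous injective `R`-module homomorphism)
      (∀ x : Set ℕ, ∀ r ∈ V x, ∀ ε : ℝ, 0 < ε → ∃ δ : ℝ, 0 < δ ∧
        ∀ s ∈ V x, d x r s < δ → |r - s| < ε) ∧
      -- (ii) if `x \ y` is finite: `V x ⊆ V y` and the inclusion is `τ x`-to-`τ y`
      -- continuous
      (∀ x y : Set ℕ, (x \ y).Finite → V x ⊆ V y ∧
        ∀ r ∈ V x, ∀ ε : ℝ, 0 < ε → ∃ δ : ℝ, 0 < δ ∧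
          ∀ s ∈ V x, d x r s < δ → d y r s < ε) ∧
      -- (iii) if `x \ y` is infinite: every `τ x`-to-`τ y` continuous `R`-module
      -- homomorphism `V x → V y` is constantly zero
      (∀ x y : Set ℕ, (x \ y).Infinite → ∀ f : ℝ → ℝ,
        Set.MapsTo f (V x) (V y) →
        (∀ r ∈ V x, ∀ ε : ℝ, 0 < ε → ∃ δ : ℝ, 0 < δ ∧
          ∀ s ∈ V x, d x r s < δ → d y (f r) (f s) < ε) →
        (∀ r ∈ V x, ∀ s ∈ V x, f (r + s) = f r + f s) →
        (∀ q : ℚ, q ∈ R → ∀ r ∈ V x, f ((q : ℝ) * r) = (q : ℝ) * f r) →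
        ∀ r ∈ V x, f r = 0) := by
  obtain ⟨a, ha, haR, hden⟩ := exists_base R hR
  have ha2 : ∀ n, 2 ≤ a n := fun n => (Nat.le_self_pow n.succ_ne_zero 2).trans (ha n)
  let N : Set ℕ → ℝ → ℝ≥0∞ := fun x => weightedNorm a (blockWeight x)
  have hw : ∀ x n, 0 ≤ blockWeight x n := fun x n => (blockWeight_pos x n).le
  have hN : ∀ x, IsExtNorm (N x) := fun x => weightedNorm_isExtNorm a (hw x)
  have hdivtop : ∀ x (k : ℤ) m, N x (k / bProd a m) ≠ ⊤ := fun x =>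
    weightedNorm_int_div_ne_top ha2 (blockWeight x)
  have hinv : ∀ x m, N x (1 / bProd a m) ≠ ⊤ := fun x m => by simpa using hdivtop x 1 m
  have hdense : ∀ x r, N x r ≠ ⊤ → ∀ ε : ℝ, 0 < ε →
      ∃ (k : ℤ) (m : ℕ), (N x (r - k / bProd a m)).toReal < ε := by
    intro x r hr ε hε
    obtain ⟨k, m, h⟩ := exists_weightedNorm_sub_lt ha2 (hw x) (blockWeight_le_one x)
      (frequently_blockWeight_eq_one x) hr (ENNReal.ofReal_pos.2 hε)
    exact ⟨k, m, ENNReal.toReal_lt_of_lt_ofReal h⟩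
  have hsmul : ∀ x, ∀ q ∈ R, ∃ C : ℝ≥0∞, C ≠ ⊤ ∧ ∀ r, N x (q * r) ≤ C * N x r := fun x q hq =>
    exists_weightedNorm_ratCast_mul_le ha2 (hw x) (blockWeight_le_one x)
      (blockWeight_succ_le x) q (hden q hq)
  refine ⟨fun x => {r | N x r ≠ ⊤}, fun x r s => (N x (r - s)).toReal, fun x => ?_, fun x => ?_,
    fun x => ⟨?_, ?_, ?_, ?_⟩, fun x => ⟨?_, ?_, ?_, ?_⟩, fun x => (hN x).complete,
    fun x => ?_, fun x r hr s hs ε hε => ?_, fun x r hr ε hε => ?_, fun x q hq r hr ε hε => ?_,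
    fun x r hr ε hε => ?_, fun x y hxy => ?_, fun x y hxy f hmaps hcont _ hlin r hr => ?_⟩
  all_goals beta_reduce at *
  · refine (hN x).not_countable fun ε hε => ?_
    obtain ⟨k, -, -, h⟩ := exists_weightedNorm_inv_bProd_lt ha (x := x)
      (K := {k | Even k}) (infinite_of_forall_exists_gt fun n => ⟨2 * (n + 1), by simp, by omega⟩)
      (fun k hk => Or.inl hk) hε 0
    exact ⟨_, (one_div_pos.2 (bProd_pos ha2 _)).ne', hinv x _, h⟩
  · exact ⟨fun k => {r | N x r ≤ k}, fun k => (hN x).isClosed_le k,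
      IsExtNorm.finite_eq_iUnion (N x)⟩
  · simp [(hN x).map_zero]
  · exact fun r hr s hs => (hN x).add_ne_top hr hs
  · intro r hr
    rwa [mem_ofPred_eq, (hN x).map_neg]
  · intro q hq r hr
    obtain ⟨C, hC, h⟩ := hsmul x q hq
    exact ne_top_of_le_ne_top (ENNReal.mul_ne_top hC hr) (h r)
  · exact fun _ _ _ _ => ENNReal.toReal_nonneg
  · exact fun r hr s hs => (hN x).toReal_sub_eq_zero_iff hr hs
  · exact fun r _ s _ => by rw [(hN x).sub_comm]
  · exact fun r hr s hs t ht => (hN x).toReal_triangle hr hs ht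
  · refine ⟨range fun p : ℤ × ℕ => (p.1 / bProd a p.2 : ℝ), countable_range _, ?_, ?_⟩
    · rintro _ ⟨p, rfl⟩
      exact hdivtop x p.1 p.2
    · intro r hr ε hε
      obtain ⟨k, m, h⟩ := hdense x r hr ε hε
      exact ⟨_, ⟨(k, m), rfl⟩, h⟩
  · refine ⟨ε / 2, half_pos hε, fun r' hr' s' hs' h1 h2 => ?_⟩
    have h := (hN x).toReal_add_le ((hN x).sub_ne_top hr hr') ((hN x).sub_ne_top hs hs')
    rw [add_sub_add_comm]
    linarith
  · refine ⟨ε, hε, fun s hs h => ?_⟩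
    rwa [neg_sub_neg, (hN x).sub_comm]
  · obtain ⟨C, hC, h⟩ := hsmul x q hq
    obtain ⟨δ, hδ, hlt⟩ := exists_toReal_lt_of_le_mul hC hε
    refine ⟨δ, hδ, fun s hs hrs => ?_⟩
    rw [← mul_sub]
    exact hlt _ _ ((hN x).sub_ne_top hr hs) (h _) hrs
  · exact ⟨ε, hε, fun s hs h =>
      ((hN x).abs_le_toReal ((hN x).sub_ne_top hr hs)).trans_lt h⟩
  · obtain ⟨C, hC, hle⟩ := exists_blockWeight_le hxy
    have h := weightedNorm_le_mul (a := a) hC hle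
    refine ⟨fun r hr => ne_top_of_le_ne_top (ENNReal.mul_ne_top ENNReal.ofReal_ne_top hr) (h r),
      fun r hr ε hε => ?_⟩
    obtain ⟨δ, hδ, hlt⟩ := exists_toReal_lt_of_le_mul (ENNReal.ofReal_ne_top (r := C)) hε
    exact ⟨δ, hδ, fun s hs hrs => hlt _ _ ((hN x).sub_ne_top hr hs) (h _) hrs⟩
  · have h1V : N x 1 ≠ ⊤ := by simpa [bProd_zero] using hinv x 0
    have hD : ∀ (k : ℤ) m, f (k / bProd a m) = k / bProd a m * f 1 := by
      intro k m
      obtain ⟨q, hq, hqeq⟩ := exists_bProd_eq R haR k m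
      rw [← hqeq, ← hlin q hq 1 h1V, mul_one]
    have hf0 : f 0 = 0 := by simpa using hD 0 0
    have hα : f 1 = 0 := by
      by_contra hne
      have hpos : 0 < min 1 |f 1| := lt_min one_pos (abs_pos.2 hne)
      have h0 : (0 : ℝ) ∈ {r | N x r ≠ ⊤} := by simp [(hN x).map_zero]
      obtain ⟨δ, hδ, h⟩ := hcont 0 h0 _ hpos
      obtain ⟨k₀, hk₀⟩ := exists_nat_ge (2 * |f 1|)
      obtain ⟨_, ⟨j, hj, rfl⟩, hk, hsmall⟩ := exists_weightedNorm_inv_bProd_lt ha (x := x)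
        (K := (fun j => 2 * j + 1) '' (x \ y)) (hxy.image fun i _ j _ hij => by simpa using hij)
        (by
          rintro _ ⟨j, hj, rfl⟩
          exact Or.inr (by rw [show (2 * j + 1) / 2 = j by omega]; exact hj.1)) hδ k₀
      have hle : k₀ ≤ a (2 ^ (2 * j + 1)) :=
        calc k₀ ≤ 2 * j + 1 := hk
          _ ≤ 2 ^ (2 * j + 1) := Nat.lt_two_pow_self.le
          _ ≤ 2 ^ (2 ^ (2 * j + 1) + 1) :=
            Nat.lt_two_pow_self.le.trans (Nat.pow_le_pow_right two_pos (Nat.le_succ _))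
          _ ≤ _ := ha _
      have hlow := min_one_abs_le_cappedDist ha2
        (hk₀.trans (by exact_mod_cast hle) : 2 * |f 1| ≤ a (2 ^ (2 * j + 1)))
      have hlow' := ofReal_le_weightedNorm a (blockWeight y) (2 ^ (2 * j + 1))
        (1 / bProd a (2 ^ (2 * j + 1) + 1) * f 1)
      rw [blockWeight_two_pow_of_notMem hj.2, one_mul] at hlow'
      have hD1 := hD 1 (2 ^ (2 * j + 1) + 1)
      rw [Int.cast_one] at hD1
      have hlt := h _ (hinv x (2 ^ (2 * j + 1) + 1)) (by
        rw [(hN x).sub_comm, sub_zero]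
        exact hsmall)
      have hmem := hmaps (hinv x (2 ^ (2 * j + 1) + 1))
      rw [hD1] at hlt hmem
      rw [hf0, (hN y).sub_comm, sub_zero] at hlt
      exact absurd ((ENNReal.ofReal_le_iff_le_toReal hmem).1
        ((ENNReal.ofReal_le_ofReal hlow).trans hlow')) (not_le.2 hlt)
    by_contra hne
    obtain ⟨δ, hδ, h⟩ := hcont r hr _ (abs_pos.2 hne)
    obtain ⟨k, m, hkm⟩ := hdense x r hr δ hδ
    have hlt := h _ (hdivtop x k m) hkm
    rw [hD, hα, mul_zero, sub_zero] at hlt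
    exact absurd ((hN y).abs_le_toReal (hmaps hr)) (not_le.2 hlt)
end

section
/- Let φ and ψ be lsc submeasures such that I = Exh(φ) and J = Exh(ψ) are translation invariant ideals, with I tall. Let a be a base sequence adapted to both I and J. Suppose there exists d > 0 such that inf{ φ(P) : P a finite interval in ℕ with ψ(P) ≥ d } = 0 (i.e., I is not included in J on intervals, as witnessed by φ and ψ). Let H_I = { r ∈ ℝ : j_a(|r|) ∈ I } and H_J = { r ∈ ℝ : j_a(|r|) ∈ J }. Then for every nonzero real number c, the set { c·r : r ∈ H_I } is not a subset of H_J. -/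
open Set Filter
open scoped ENNReal

section Digits

variable {a : ℕ → ℕ}

lemma two_pow_mul_bProd_le (ha : ∀ n, 2 ≤ a n) (n i : ℕ) :
    2 ^ i * bProd a n ≤ bProd a (n + i) := by
  induction i with
  | zero => simp
  | succ i ih =>
    have h2 : (2 : ℝ) ≤ a (n + i) := by exact_mod_cast ha (n + i)
    have hp := bProd_pos ha (n + i)
    rw [← add_assoc, bProd_succ, pow_succ]
    nlinarith

lemma bProd_mono (ha : ∀ n, 2 ≤ a n) : Monotone (bProd a) :=
  monotone_nat_of_le_succ fun n => by
    have h := two_pow_mul_bProd_le ha n 1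
    have := bProd_pos ha n
    linarith

lemma digit_eq (a : ℕ → ℕ) (x : ℝ) (n : ℕ) :
    digit a x n = ⌊bProd a (n + 1) * x⌋ - (a n : ℤ) * ⌊bProd a n * x⌋ := by
  have key : ∀ m, ⌊bProd a m * Int.fract x⌋
      = ⌊bProd a m * x⌋ - (∏ k ∈ Finset.range m, (a k : ℤ)) * ⌊x⌋ := fun m => by
    rw [← Int.floor_sub_intCast, Int.fract, bProd]
    push_cast
    ring_nf
  rw [digit, key, key, Finset.prod_range_succ]
  ring

lemma exists_int_bProd_mul_of_le {s n : ℕ} (hsn : s ≤ n) {R : ℝ}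
    (h : ∃ K : ℤ, bProd a s * R = K) : ∃ K : ℤ, bProd a n * R = K := by
  induction n, hsn using Nat.le_induction with
  | base => exact h
  | succ n _ ih =>
    obtain ⟨K, hK⟩ := ih
    refine ⟨K * a n, ?_⟩
    rw [bProd_succ, mul_right_comm, hK]
    push_cast
    rfl

/-- If `R` has a finite expansion of length `s`, then a number just above `R` has zero digits
between `s` and the scale of the perturbation. -/
lemma digit_eq_zero_of_near (ha : ∀ n, 2 ≤ a n) {s t n : ℕ} {R x : ℝ}
    (hR : ∃ K : ℤ, bProd a s * R = K) (hRx : R ≤ x) (hx : x < R + 1 / bProd a t)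
    (hsn : s ≤ n) (hnt : n < t) : digit a x n = 0 := by
  have key : ∀ m, s ≤ m → m ≤ t → ((⌊bProd a m * x⌋ : ℤ) : ℝ) = bProd a m * R := by
    intro m hm hmt
    obtain ⟨K, hK⟩ := exists_int_bProd_mul_of_le hm hR
    have hp := bProd_pos ha m
    have hq := bProd_pos ha t
    have hle := bProd_mono ha hmt
    have hd : bProd a m * (1 / bProd a t) ≤ 1 := by
      rw [mul_one_div, div_le_one hq]
      exact hle
    have hfl : ⌊bProd a m * x⌋ = K := by
      rw [Int.floor_eq_iff, ← hK]
      constructor <;> nlinarith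
    rw [hfl, hK]
  have h1 := key (n + 1) (by omega) (by omega)
  have h0 := key n hsn hnt.le
  rw [bProd_succ a n] at h1
  rw [digit_eq, bProd_succ]
  have : ((⌊bProd a n * ↑(a n) * x⌋ - (a n : ℤ) * ⌊bProd a n * x⌋ : ℤ) : ℝ) = 0 := by
    push_cast
    rw [h0, h1]
    ring
  exact_mod_cast this

/-- The numerator, at level `p + i`, of the number with integer part `N` at level `p`
followed by the digits `0, 1, 0, 1, …`. -/
def altNum (a : ℕ → ℕ) (p : ℕ) (N : ℤ) : ℕ → ℤ
  | 0 => N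
  | i + 1 => a (p + i) * altNum a p N i + (i % 2 : ℕ)

lemma floor_eq_altNum (ha : ∀ n, 2 ≤ a n) {p : ℕ} {N : ℤ} {j : ℕ} {y : ℝ}
    (h : ⌊bProd a (p + j) * y⌋ = altNum a p N j) {i : ℕ} (hij : i ≤ j) :
    ⌊bProd a (p + i) * y⌋ = altNum a p N i := by
  induction j, hij using Nat.le_induction with
  | base => exact h
  | succ j _ ih =>
    apply ih
    rw [Int.floor_eq_iff] at h ⊢
    rw [← add_assoc, bProd_succ, altNum] at h
    have h2 : (2 : ℝ) ≤ a (p + j) := by exact_mod_cast ha (p + j)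
    have hm : j % 2 ≤ 1 := by omega
    generalize j % 2 = e at h hm
    have hm0 : (0 : ℝ) ≤ e := Nat.cast_nonneg _
    have hm1 : (e : ℝ) ≤ 1 := by exact_mod_cast hm
    obtain ⟨hl, hr⟩ := h
    push_cast at hl hr
    constructor
    · refine le_of_mul_le_mul_left ?_ (by linarith : (0 : ℝ) < a (p + j))
      nlinarith
    · refine lt_of_mul_lt_mul_left ?_ (by linarith : (0 : ℝ) ≤ a (p + j))
      nlinarith

lemma digit_eq_of_floor_eq_altNum (ha : ∀ n, 2 ≤ a n) {p : ℕ} {N : ℤ} {j : ℕ} {y : ℝ}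
    (h : ⌊bProd a (p + j) * y⌋ = altNum a p N j) {i : ℕ} (hij : i < j) :
    digit a y (p + i) = (i % 2 : ℕ) := by
  rw [digit_eq, floor_eq_altNum ha h hij.le, add_assoc,
    floor_eq_altNum ha h (Nat.succ_le_of_lt hij), altNum]
  ring

/-- Any `R` can be increased slightly to a finite expansion `R'` such that `C * x` has
alternating digits on a prescribed interval for all `x` near `R'`. -/
lemma exists_alternating_extension (ha : ∀ n, 2 ≤ a n) {C : ℝ} (hC : 0 < C) {L : ℕ}
    (hL₁ : 2 * C < 2 ^ L) (hL₂ : 2 / C + 2 < 2 ^ L) (u q : ℕ) (huq : u + L + 1 ≤ q) (R : ℝ) :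
    ∃ R' : ℝ, R ≤ R' ∧ R' + 1 / bProd a (q + L + 2) < R + 1 / bProd a (u + 1) ∧
      (∃ K : ℤ, bProd a (q + L + 2) * R' = K) ∧
      ∀ x ∈ Icc R' (R' + 1 / bProd a (q + L + 2)),
        Icc (u + L + 1) q ⊆ jSet a (C * x) := by
  set p := u + L + 1 with hp
  obtain ⟨j, hj⟩ : ∃ j, q + 2 = p + j := ⟨q + 2 - p, by omega⟩
  set N : ℤ := ⌊bProd a p * (C * R)⌋ + 1 with hN
  set z : ℝ := altNum a p N j / bProd a (p + j) with hz
  have hAp := bProd_pos ha p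
  have hAj := bProd_pos ha (p + j)
  have hAT := bProd_pos ha (q + L + 2)
  have hAu := bProd_pos ha (u + 1)
  have hzj : bProd a (p + j) * z = altNum a p N j := by
    rw [hz]; field_simp
  have hzp : ⌊bProd a p * z⌋ = N := by
    have := floor_eq_altNum ha (y := z) (p := p) (N := N) (j := j) (i := 0)
      (by rw [hzj, Int.floor_intCast]) (Nat.zero_le _)
    simpa [altNum] using this
  have hz1 : C * R ≤ z := by
    have h1 : bProd a p * (C * R) < N := by
      rw [hN]; push_cast; exact Int.lt_floor_add_one _
    have h2 : (N : ℝ) ≤ bProd a p * z := hzp ▸ Int.floor_le _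
    exact le_of_mul_le_mul_left (by linarith) hAp
  have hz2 : bProd a p * z < bProd a p * (C * R) + 2 := by
    have h1 : bProd a p * z < N + 1 := hzp ▸ Int.lt_floor_add_one _
    have h2 : (N : ℝ) ≤ bProd a p * (C * R) + 1 := by
      rw [hN]; push_cast; linarith [Int.floor_le (bProd a p * (C * R))]
    linarith
  have hTj : 2 ^ L * bProd a (p + j) ≤ bProd a (q + L + 2) := by
    have := two_pow_mul_bProd_le ha (p + j) L
    rwa [← hj, show q + 2 + L = q + L + 2 by ring, hj] at this
  have hpu : 2 ^ L * bProd a (u + 1) ≤ bProd a p := by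
    have := two_pow_mul_bProd_le ha (u + 1) L
    rwa [show u + 1 + L = p by omega] at this
  have hTp : bProd a p ≤ bProd a (q + L + 2) := bProd_mono ha (by omega)
  set B := bProd a (q + L + 2) with hB
  set R' : ℝ := ⌈B * (z / C)⌉ / B with hR'
  have hBR' : B * R' = ⌈B * (z / C)⌉ := by rw [hR']; field_simp
  have hlow : z / C ≤ R' := by
    refine le_of_mul_le_mul_left ?_ hAT
    rw [hBR']; exact Int.le_ceil _
  have hup : R' < z / C + 1 / B := by
    refine lt_of_mul_lt_mul_left ?_ hAT.le
    rw [hBR', mul_add, mul_one_div_cancel hAT.ne']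
    exact Int.ceil_lt_add_one _
  have hzC : C * (z / C) = z := by field_simp
  refine ⟨R', ?_, ?_, ⟨_, hBR'⟩, ?_⟩
  · refine le_trans ?_ hlow
    rw [le_div_iff₀ hC]; linarith
  · have h1 : z / C < R + (2 / C) / bProd a p := by
      rw [div_lt_iff₀ hC]
      have : (R + 2 / C / bProd a p) * C = C * R + 2 / bProd a p := by field_simp
      rw [this]
      refine lt_of_mul_lt_mul_left ?_ hAp.le
      rw [mul_add, mul_div_cancel₀ _ hAp.ne']
      exact hz2
    have h2 : 1 / B ≤ 1 / bProd a p := one_div_le_one_div_of_le hAp hTp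
    have h3 : (2 / C) / bProd a p + 2 * (1 / bProd a p) < 1 / bProd a (u + 1) := by
      rw [show (2 / C) / bProd a p + 2 * (1 / bProd a p) = (2 / C + 2) / bProd a p by ring,
        div_lt_div_iff₀ hAp hAu]
      nlinarith
    linarith
  · intro x hx n hn
    have hfl : ⌊bProd a (p + j) * (C * x)⌋ = altNum a p N j := by
      rw [Int.floor_eq_iff, ← hzj]
      constructor
      · refine mul_le_mul_of_nonneg_left ?_ hAj.le
        rw [← hzC]
        exact mul_le_mul_of_nonneg_left (hlow.trans hx.1) hC.le
      · have h1 : C * x < z + 2 * C / B := by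
          have : x < z / C + 2 / B := by
            have := hx.2
            have e : 2 / B = 1 / B + 1 / B := by ring
            linarith
          calc C * x < C * (z / C + 2 / B) := mul_lt_mul_of_pos_left this hC
            _ = z + 2 * C / B := by rw [mul_add, hzC]; ring
        have h2 : bProd a (p + j) * (2 * C / B) ≤ 1 := by
          rw [← mul_div_assoc, div_le_one hAT]
          nlinarith
        nlinarith
    obtain ⟨i, rfl⟩ := Nat.exists_eq_add_of_le hn.1
    have hi := hn.2
    change digit a (C * x) (p + i) ≠ digit a (C * x) (p + i + 1)
    rw [digit_eq_of_floor_eq_altNum ha hfl (by omega), add_assoc,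
      digit_eq_of_floor_eq_altNum ha hfl (by omega)]
    omega

end Digits

section Submeasures

variable {φ ψ : Set ℕ → ℝ≥0∞}

lemma IsLscSubmeasure.biUnion_finset_le (hφ : IsLscSubmeasure φ) (s : Finset ℕ)
    (B : ℕ → Set ℕ) : φ (⋃ k ∈ s, B k) ≤ ∑ k ∈ s, φ (B k) := by
  classical
  induction s using Finset.induction_on with
  | empty => simp [hφ.1]
  | insert i s hi ih =>
    rw [Finset.set_biUnion_insert, Finset.sum_insert hi]
    exact (hφ.2.2.1 _ _).trans (add_le_add_right ih _)

lemma IsLscSubmeasure.le_tsum (hφ : IsLscSubmeasure φ) {B : ℕ → Set ℕ} {x : Set ℕ}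
    (hB : ∀ k, ∀ n ∈ B k, k ≤ n) (hx : x ⊆ ⋃ k, B k) : φ x ≤ ∑' k, φ (B k) := by
  rw [hφ.2.2.2.2 x]
  refine iSup_le fun M => ?_
  calc φ (x ∩ {k | k < M}) ≤ φ (⋃ k ∈ Finset.range M, B k) := by
        refine hφ.2.1 fun n hn => ?_
        obtain ⟨k, hk⟩ := mem_iUnion.1 (hx hn.1)
        have hlt : n < M := hn.2
        exact mem_biUnion (Finset.mem_coe.2 (Finset.mem_range.2 ((hB k n hk).trans_lt hlt))) hk
    _ ≤ ∑ k ∈ Finset.range M, φ (B k) := hφ.biUnion_finset_le _ _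
    _ ≤ ∑' k, φ (B k) := ENNReal.sum_le_tsum _

lemma IsLscSubmeasure.mem_Exh_of_subset_iUnion (hφ : IsLscSubmeasure φ) {B : ℕ → Set ℕ}
    {s : ℕ → ℕ} {x : Set ℕ} (hB : ∀ k, ∀ n ∈ B k, k ≤ n) (hBs : ∀ k, ∀ n ∈ B k, n ≤ s k)
    (hs : Monotone s) (hx : x ⊆ ⋃ k, B k) (hsum : ∑' k, φ (B k) ≠ ⊤) : x ∈ Exh φ := by
  have hanti : Antitone fun n => φ (x \ {k | k < n}) := fun m n hmn =>
    hφ.2.1 (sdiff_subset_sdiff_right fun k (hk : k < m) => hk.trans_le hmn)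
  change Tendsto (fun n => φ (x \ {k | k < n})) atTop (nhds 0)
  rw [ENNReal.tendsto_nhds_zero]
  intro ε hε
  obtain ⟨K, hK⟩ := (ENNReal.tendsto_nhds_zero.1
    (ENNReal.tendsto_sum_nat_add (fun k => φ (B k)) hsum) ε hε).exists
  filter_upwards [eventually_ge_atTop (s K + 1)] with n hn
  refine (hanti hn).trans (le_trans ?_ hK)
  refine hφ.le_tsum (B := fun k => B (k + K)) (fun k m hm => ?_) fun m hm => ?_
  · exact le_trans (by omega) (hB _ _ hm)
  · obtain ⟨k, hk⟩ := mem_iUnion.1 (hx hm.1)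
    have hmK : s K < m := by
      have := hm.2
      simp only [mem_ofPred_eq, not_lt] at this
      omega
    have hKk : K ≤ k := by
      by_contra! hlt
      exact absurd ((hBs k m hk).trans (hs hlt.le)) (not_le.2 hmK)
    refine mem_iUnion.2 ⟨k - K, ?_⟩
    rwa [Nat.sub_add_cancel hKk]

lemma IsLscSubmeasure.tendsto_singleton_of_tall (hφ : IsLscSubmeasure φ)
    (htall : TallIdeal (Exh φ)) : Tendsto (fun n => φ {n}) atTop (nhds 0) := by
  rw [ENNReal.tendsto_nhds_zero]
  intro ε hε
  by_contra hcon
  obtain ⟨y, hyx, hyinf, hy⟩ := htall {n | ¬ φ {n} ≤ ε}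
    (Nat.frequently_atTop_iff_infinite.1 (not_eventually.1 hcon))
  have hy' : Tendsto (fun n => φ (y \ {k | k < n})) atTop (nhds 0) := hy
  obtain ⟨n, hn⟩ := (ENNReal.tendsto_nhds_zero.1 hy' ε hε).exists
  obtain ⟨m, hmy, hm⟩ := hyinf.exists_gt n
  have hmem : m ∈ y \ {k | k < n} := ⟨hmy, by
    simp only [mem_ofPred_eq]
    omega⟩
  exact hyx hmy ((hφ.2.1 (singleton_subset_iff.2 hmem)).trans hn)

lemma IsLscSubmeasure.exists_far_interval (hφ : IsLscSubmeasure φ) (hψ : IsLscSubmeasure ψ)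
    {d : ℝ≥0∞} (hd : 0 < d)
    (hint : ∀ ε : ℝ≥0∞, 0 < ε →
      ∃ m n : ℕ, d ≤ ψ (Set.Icc m n) ∧ φ (Set.Icc m n) < ε)
    (N : ℕ) {ε : ℝ≥0∞} (hε : 0 < ε) :
    ∃ m n : ℕ, N ≤ m ∧ m ≤ n ∧ d ≤ ψ (Set.Icc m n) ∧ φ (Set.Icc m n) < ε := by
  obtain ⟨δ, hδ, hδN⟩ : ∃ δ : ℝ≥0∞, 0 < δ ∧ ∀ k < N, δ ≤ φ {k} := by
    induction N with
    | zero => exact ⟨1, one_pos, by simp⟩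
    | succ N ih =>
      obtain ⟨δ, hδ, h⟩ := ih
      refine ⟨min δ (φ {N}), lt_min hδ (hφ.2.2.2.1 N).1, fun k hk => ?_⟩
      rcases Nat.lt_succ_iff_lt_or_eq.1 hk with hk | rfl
      · exact (min_le_left _ _).trans (h k hk)
      · exact min_le_right _ _
  obtain ⟨m, n, hψmn, hφmn⟩ := hint (min ε δ) (lt_min hε hδ)
  have hmn : m ≤ n := by
    by_contra! hlt
    rw [Icc_eq_empty (not_le.2 hlt), hψ.1] at hψmn
    exact absurd hd (not_lt.2 hψmn)
  refine ⟨m, n, ?_, hmn, hψmn, hφmn.trans_le (min_le_left _ _)⟩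
  by_contra! hlt
  have h1 : φ {m} ≤ φ (Icc m n) := hφ.2.1 (singleton_subset_iff.2 ⟨le_rfl, hmn⟩)
  exact absurd (hφmn.trans_le ((min_le_right _ _).trans (hδN m hlt))) (not_lt.2 h1)

/-- Tallness allows widening the witnessing intervals by bounded amounts on both sides. -/
lemma IsLscSubmeasure.exists_far_widened_interval (hφ : IsLscSubmeasure φ)
    (hψ : IsLscSubmeasure ψ) (htall : TallIdeal (Exh φ)) {d : ℝ≥0∞} (hd : 0 < d)
    (hint : ∀ ε : ℝ≥0∞, 0 < ε →
      ∃ m n : ℕ, d ≤ ψ (Set.Icc m n) ∧ φ (Set.Icc m n) < ε)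
    (i j N : ℕ) {ε : ℝ≥0∞} (hε : 0 < ε) :
    ∃ u q : ℕ, N ≤ u ∧ u + i ≤ q ∧ d ≤ ψ (Set.Icc (u + i) q) ∧
      φ (Set.Icc u (q + j)) < ε := by
  have hsing : ∀ ε : ℝ≥0∞, 0 < ε → ∃ M, ∀ n ≥ M, φ {n} ≤ ε := fun ε hε =>
    eventually_atTop.1 (ENNReal.tendsto_nhds_zero.1 (hφ.tendsto_singleton_of_tall htall) ε hε)
  have hadd : ∀ {S : Set ℕ} {n : ℕ} {ε : ℝ≥0∞}, φ S < ε / 2 → φ {n} ≤ ε / 2 →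
      φ (insert n S) < ε := fun {S n ε} hS hn => by
    rw [insert_eq]
    refine (hφ.2.2.1 _ _).trans_lt ?_
    rw [← ENNReal.add_halves ε]
    exact ENNReal.add_lt_add_of_le_of_lt (hφ.2.2.2.1 n).2.ne hn hS
  induction i generalizing N ε with
  | zero =>
    induction j generalizing N ε with
    | zero => exact hφ.exists_far_interval hψ hd hint N hε
    | succ j ih =>
      obtain ⟨M, hM⟩ := hsing (ε / 2) (ENNReal.half_pos hε.ne')
      obtain ⟨u, q, hu, huq, hψu, hφu⟩ := ih (max N M) (ENNReal.half_pos hε.ne')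
      refine ⟨u, q, (le_max_left _ _).trans hu, huq, hψu, ?_⟩
      refine (hφ.2.1 ?_).trans_lt (hadd hφu (hM (q + j + 1) ?_))
      · intro k hk
        simp only [mem_Icc, mem_insert_iff] at hk ⊢
        omega
      · have := le_max_right N M
        omega
  | succ i ih =>
    obtain ⟨M, hM⟩ := hsing (ε / 2) (ENNReal.half_pos hε.ne')
    obtain ⟨u, q, hu, huq, hψu, hφu⟩ := ih (max N M + 1) (ENNReal.half_pos hε.ne')
    obtain ⟨v, rfl⟩ : ∃ v, u = v + 1 := ⟨u - 1, by omega⟩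
    have h1 := le_max_left N M
    have h2 := le_max_right N M
    rw [show v + 1 + i = v + (i + 1) by ring] at huq hψu
    refine ⟨v, q, by omega, huq, hψu, ?_⟩
    refine (hφ.2.1 ?_).trans_lt (hadd hφu (hM v (by omega)))
    intro k hk
    simp only [mem_Icc, mem_insert_iff] at hk ⊢
    omega

end Submeasures

/-- Theorem 3.2: strong non-inclusion `c · H_I ⊄ H_J`. -/
theorem smul_Hset_not_subset (a : ℕ → ℕ) (ha : ∀ n, 2 ≤ a n)
    (φ ψ : Set ℕ → ℝ≥0∞) (hφ : IsLscSubmeasure φ) (hψ : IsLscSubmeasure ψ)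
    (hidI : IsIdeal (Exh φ)) (hidJ : IsIdeal (Exh ψ))
    (htrI : TransInv (Exh φ)) (htrJ : TransInv (Exh ψ))
    (htall : TallIdeal (Exh φ))
    (hadI : AdaptedTo a (Exh φ)) (hadJ : AdaptedTo a (Exh ψ))
    (d : ℝ≥0∞) (hd : 0 < d)
    (hint : ∀ ε : ℝ≥0∞, 0 < ε →
      ∃ m n : ℕ, d ≤ ψ (Set.Icc m n) ∧ φ (Set.Icc m n) < ε) :
    ∀ c : ℝ, c ≠ 0 →
      ¬ ((fun r : ℝ => c * r) '' Hset a (Exh φ) ⊆ Hset a (Exh ψ)) := by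
  intro c hc hsub
  have hC : 0 < |c| := abs_pos.2 hc
  obtain ⟨L, hL⟩ := pow_unbounded_of_one_lt (max (2 * |c|) (2 / |c| + 2)) one_lt_two
  have hL₁ := (le_max_left _ _).trans_lt hL
  have hL₂ := (le_max_right _ _).trans_lt hL
  obtain ⟨ε, hε, hεsum⟩ := ENNReal.exists_pos_sum_of_countable (one_ne_zero (α := ℝ≥0∞)) ℕ
  choose U Q hU hUQ hψU hφU using fun N k : ℕ =>
    hφ.exists_far_widened_interval hψ htall hd hint (L + 1) (L + 2) N
      (ENNReal.coe_pos.2 (hε k))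
  choose E hE₁ hE₂ hE₃ hE₄ using exists_alternating_extension ha hC hL₁ hL₂
  -- the `k`-th block is `Icc (u k) (s (k + 1))`
  let s : ℕ → ℕ := fun k => Nat.rec 0 (fun k N => Q N k + L + 2) k
  let u : ℕ → ℕ := fun k => U (s k) k
  let q : ℕ → ℕ := fun k => Q (s k) k
  have hs : ∀ k, s (k + 1) = q k + L + 2 := fun _ => rfl
  have hsu : ∀ k, s k ≤ u k := fun k => hU _ _
  have huq : ∀ k, u k + L + 1 ≤ q k := fun k => hUQ _ _
  have hs_strict : StrictMono s := strictMono_nat_of_lt_succ fun k => by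
    have := hs k; have := hsu k; have := huq k; omega
  let R : ℕ → ℝ := fun k => Nat.rec 0 (fun k R => E (u k) (q k) (huq k) R) k
  have hR_mono : Monotone R := monotone_nat_of_le_succ fun k => hE₁ (u k) (q k) (huq k) (R k)
  have hR_lt : ∀ k, R (k + 1) + 1 / bProd a (s (k + 1)) < R k + 1 / bProd a (u k + 1) :=
    fun k => hE₂ (u k) (q k) (huq k) (R k)
  have hR_int : ∀ k, ∃ K : ℤ, bProd a (s k) * R k = K := fun k => by
    cases k with
    | zero => exact ⟨0, by simp [R]⟩
    | succ k => exact hE₃ (u k) (q k) (huq k) (R k)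
  have hR_anti : Antitone fun k => R k + 1 / bProd a (s k) :=
    antitone_nat_of_succ_le fun k => (hR_lt k).le.trans <| by
      gcongr
      · exact bProd_pos ha _
      · exact bProd_mono ha ((hsu k).trans (Nat.le_succ _))
  have hR_le : ∀ i k, R i ≤ R k + 1 / bProd a (s k) := fun i k => by
    have h1 := hR_mono (le_max_left i k)
    have h2 := hR_anti (le_max_right i k)
    have h3 := bProd_pos ha (s (max i k))
    have h4 : 0 < 1 / bProd a (s (max i k)) := by positivity
    simp only at h2
    linarith
  have hbdd : BddAbove (range R) := ⟨R 0 + 1 / bProd a (s 0), by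
    rintro _ ⟨i, rfl⟩; exact hR_le i 0⟩
  set r : ℝ := ⨆ k, R k with hr
  have hRr : ∀ k, R k ≤ r := le_ciSup hbdd
  have hrR : ∀ k, r ≤ R k + 1 / bProd a (s k) := fun k => ciSup_le fun i => hR_le i k
  have hr0 : 0 ≤ r := hRr 0
  have hblock : jSet a r ⊆ ⋃ k, Icc (u k) (s (k + 1)) := by
    intro n hn
    obtain ⟨k, hk, hk'⟩ : ∃ k, s k ≤ n ∧ n < s (k + 1) := by
      have hex : ∃ k, n < s k := ⟨n + 1, (Nat.lt_succ_self n).trans_le hs_strict.le_apply⟩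
      have hne : Nat.find hex ≠ 0 := fun h0 => by
        have := Nat.find_spec hex
        rw [h0] at this
        exact absurd this (Nat.not_lt_zero n)
      obtain ⟨k, hk⟩ := Nat.exists_eq_succ_of_ne_zero hne
      refine ⟨k, not_lt.1 (Nat.find_min hex (by omega)), ?_⟩
      have := Nat.find_spec hex
      rwa [hk] at this
    refine mem_iUnion.2 ⟨k, ?_, hk'.le⟩
    by_contra! hlt
    have hrlt := (hrR (k + 1)).trans_lt (hR_lt k)
    refine hn ?_
    rw [digit_eq_zero_of_near ha (hR_int k) (hRr k) hrlt hk (by omega),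
      digit_eq_zero_of_near ha (hR_int k) (hRr k) hrlt (by omega : s k ≤ n + 1) (by omega)]
  have hrI : r ∈ Hset a (Exh φ) := by
    change jSet a |r| ∈ Exh φ
    rw [abs_of_nonneg hr0]
    refine hφ.mem_Exh_of_subset_iUnion (s := fun k => s (k + 1))
      (fun k n hn => (hs_strict.le_apply.trans (hsu k)).trans hn.1) (fun k n hn => hn.2)
      (fun i k hik => hs_strict.monotone (Nat.succ_le_succ hik)) hblock ?_
    exact ((ENNReal.tsum_le_tsum fun k => (hφU (s k) k).le).trans_lt
      (hεsum.trans ENNReal.one_lt_top)).ne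
  have hrJ : jSet a |c * r| ∈ Exh ψ := hsub ⟨r, hrI, rfl⟩
  rw [abs_mul, abs_of_nonneg hr0] at hrJ
  obtain ⟨n, hn⟩ := ((tendsto_order.1 hrJ).2 d hd).exists
  refine absurd hn (not_lt.2 ((hψU (s n) n).trans (hψ.2.1 fun m hm => ⟨?_, ?_⟩)))
  · exact hE₄ (u n) (q n) (huq n) (R n) r ⟨hRr (n + 1), hrR (n + 1)⟩ hm
  · have h1 : n ≤ u n := hs_strict.le_apply.trans (hsu n)
    have h2 : u n + (L + 1) ≤ m := hm.1
    simp only [mem_ofPred_eq]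
    omega
end
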